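/- arXiv:1208.2856 — 2 statements merged into one kernel-verified Lean document; each statement's English description precedes it below -/
import Mathlib

section
/- For every n ≥ 0, the abelian complexity function ρ of the ordinary paperfolding word satisfies ρ(16n+9) = ρ(2n+1) + 2. -/
/-- The ordinary paperfolding word over `{0,1}`, indexed from 1:
writing `n = n' * 2^k` with `n'` odd, `pf n = 0` if `n' ≡ 1 (mod 4)`
and `pf n = 1` if `n' ≡ 3 (mod 4)`.  (The value at `0` is irrelevant.) -/
def pf (n : ℕ) : ℕ := if (n / 2 ^ (n.factorization 2)) % 4 = 1 then 0 else 1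

/-- The factor `f_i f_{i+1} ⋯ f_{i+n-1}` of the paperfolding word,
of length `n`, starting at position `i`. -/
def pfFactor (i n : ℕ) : List ℕ := (List.range n).map (fun j => pf (i + j))

/-- `w` is a factor of the ordinary paperfolding word. -/
def IsPFFactor (w : List ℕ) : Prop := ∃ i : ℕ, 1 ≤ i ∧ w = pfFactor i w.length

/-- The abelian complexity function of the ordinary paperfolding word:
the number of abelian equivalence classes of factors of length `n`,
where the class of a factor `w` is determined by the pair
`(|w|_0, |w|_1)` of numbers of occurrences of `0` and `1` in `w`. -/
noncomputable def ρ (n : ℕ) : ℕ :=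
  {p : ℕ × ℕ | ∃ i : ℕ, 1 ≤ i ∧
    p = ((pfFactor i n).count 0, (pfFactor i n).count 1)}.ncard

/-- `Δ w = |w|_0 - |w|_1`. -/
def Δ (w : List ℕ) : ℤ := (w.count 0 : ℤ) - (w.count 1 : ℤ)

/-- `M n` is the maximum of `Δ w` over all factors `w` of the
paperfolding word of length `n`. -/
noncomputable def M (n : ℕ) : ℤ :=
  sSup {d : ℤ | ∃ i : ℕ, 1 ≤ i ∧ d = Δ (pfFactor i n)}

lemma pf_two_mul {m : ℕ} (hm : m ≠ 0) : pf (2 * m) = pf m := by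
  have h : (2 * m).factorization 2 = m.factorization 2 + 1 := by
    rw [Nat.factorization_mul two_ne_zero hm]
    simp [Nat.prime_two.factorization_self, add_comm]
  unfold pf
  rw [h, pow_succ', Nat.mul_div_mul_left _ _ two_pos]

lemma pf_odd {m : ℕ} (hm : m % 2 = 1) : pf m = if m % 4 = 1 then 0 else 1 := by
  have h : m.factorization 2 = 0 := Nat.factorization_eq_zero_of_not_dvd (by omega)
  simp [pf, h]

lemma pf_le_one (m : ℕ) : pf m ≤ 1 := by
  unfold pf
  split_ifs <;> simp

/-- The number of ones among the first `n` letters of the paperfolding word. -/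
def pfOnes (n : ℕ) : ℕ := ∑ i ∈ Finset.range n, pf (i + 1)

lemma pfOnes_succ (n : ℕ) : pfOnes (n + 1) = pfOnes n + pf (n + 1) :=
  Finset.sum_range_succ _ _

/-- The letters of the paperfolding word in a block of length sixteen. -/
lemma pf_block (c : ℕ) :
    pf (16 * c + 1) = 0 ∧ pf (16 * c + 2) = 0 ∧ pf (16 * c + 3) = 1 ∧ pf (16 * c + 4) = 0 ∧
    pf (16 * c + 5) = 0 ∧ pf (16 * c + 6) = 1 ∧ pf (16 * c + 7) = 1 ∧
    pf (16 * c + 8) = pf (2 * c + 1) ∧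
    pf (16 * c + 9) = 0 ∧ pf (16 * c + 10) = 0 ∧ pf (16 * c + 11) = 1 ∧ pf (16 * c + 12) = 1 ∧
    pf (16 * c + 13) = 0 ∧ pf (16 * c + 14) = 1 ∧ pf (16 * c + 15) = 1 ∧
    pf (16 * c + 16) = pf (2 * c + 2) := by
  have one {x : ℕ} (h : x % 4 = 1) : pf x = 0 := by rw [pf_odd (by omega), if_pos h]
  have three {x : ℕ} (h : x % 4 = 3) : pf x = 1 := by rw [pf_odd (by omega), if_neg (by omega)]
  have half {x : ℕ} (y : ℕ) (h : x = 2 * y) (hy : y ≠ 0) : pf x = pf y := by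
    rw [h, pf_two_mul hy]
  refine ⟨one (by omega), ?_, three (by omega), ?_, one (by omega), ?_, three (by omega), ?_,
    one (by omega), ?_, three (by omega), ?_, one (by omega), ?_, three (by omega), ?_⟩
  · rw [half (8 * c + 1) (by ring) (by omega), one (by omega)]
  · rw [half (8 * c + 2) (by ring) (by omega), half (4 * c + 1) (by ring) (by omega),
      one (by omega)]
  · rw [half (8 * c + 3) (by ring) (by omega), three (by omega)]
  · rw [half (8 * c + 4) (by ring) (by omega), half (4 * c + 2) (by ring) (by omega),
      half (2 * c + 1) (by ring) (by omega)]
  · rw [half (8 * c + 5) (by ring) (by omega), one (by omega)]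
  · rw [half (8 * c + 6) (by ring) (by omega), half (4 * c + 3) (by ring) (by omega),
      three (by omega)]
  · rw [half (8 * c + 7) (by ring) (by omega), three (by omega)]
  · rw [half (8 * c + 8) (by ring) (by omega), half (4 * c + 4) (by ring) (by omega),
      half (2 * c + 2) (by ring) (by omega)]

lemma pfOnes_sixteen_mul (c : ℕ) : pfOnes (16 * c) = pfOnes (2 * c) + 7 * c := by
  induction c with
  | zero => rfl
  | succ c ih =>
    obtain ⟨h1, h2, h3, h4, h5, h6, h7, h8, h9, h10, h11, h12, h13, h14, h15, h16⟩ := pf_block c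
    have h : pfOnes (2 * (c + 1)) = pfOnes (2 * c) + pf (2 * c + 1) + pf (2 * c + 2) := by
      rw [← pfOnes_succ, ← pfOnes_succ]
      rfl
    rw [h, show 16 * (c + 1) = 16 * c + 16 by ring]
    simp only [pfOnes_succ, h1, h2, h3, h4, h5, h6, h7, h8, h9, h10, h11, h12, h13, h14, h15,
      h16, ih]
    ring

lemma pfOnes_block (c : ℕ) :
    pfOnes (16 * c + 1) = pfOnes (2 * c) + 7 * c ∧
    pfOnes (16 * c + 2) = pfOnes (2 * c) + 7 * c ∧
    pfOnes (16 * c + 3) = pfOnes (2 * c) + 7 * c + 1 ∧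
    pfOnes (16 * c + 4) = pfOnes (2 * c) + 7 * c + 1 ∧
    pfOnes (16 * c + 5) = pfOnes (2 * c) + 7 * c + 1 ∧
    pfOnes (16 * c + 6) = pfOnes (2 * c) + 7 * c + 2 ∧
    pfOnes (16 * c + 7) = pfOnes (2 * c) + 7 * c + 3 ∧
    pfOnes (16 * c + 8) = pfOnes (2 * c + 1) + 7 * c + 3 ∧
    pfOnes (16 * c + 9) = pfOnes (2 * c + 1) + 7 * c + 3 ∧
    pfOnes (16 * c + 10) = pfOnes (2 * c + 1) + 7 * c + 3 ∧
    pfOnes (16 * c + 11) = pfOnes (2 * c + 1) + 7 * c + 4 ∧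
    pfOnes (16 * c + 12) = pfOnes (2 * c + 1) + 7 * c + 5 ∧
    pfOnes (16 * c + 13) = pfOnes (2 * c + 1) + 7 * c + 5 ∧
    pfOnes (16 * c + 14) = pfOnes (2 * c + 1) + 7 * c + 6 ∧
    pfOnes (16 * c + 15) = pfOnes (2 * c + 1) + 7 * c + 7 := by
  obtain ⟨h1, h2, h3, h4, h5, h6, h7, h8, h9, h10, h11, h12, h13, h14, h15, -⟩ := pf_block c
  simp only [pfOnes_succ, h1, h2, h3, h4, h5, h6, h7, h8, h9, h10, h11, h12, h13, h14, h15,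
    pfOnes_sixteen_mul, add_zero, true_and]
  omega

lemma count_one_pfFactor (a L : ℕ) :
    (pfFactor (a + 1) L).count 1 + pfOnes a = pfOnes (a + L) := by
  induction L with
  | zero => simp [pfFactor]
  | succ L ih =>
    have h : (pfFactor (a + 1) (L + 1)).count 1 =
        (pfFactor (a + 1) L).count 1 + pf (a + L + 1) := by
      have e : a + 1 + L = a + L + 1 := by ring
      have := pf_le_one (a + L + 1)
      simp only [pfFactor, List.range_succ, List.map_append, List.count_append, List.map_cons,
        List.map_nil, e, List.count_singleton]
      interval_cases pf (a + L + 1) <;> simp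
    rw [h, ← add_assoc, pfOnes_succ, ← ih]
    ring

lemma count_zero_add_count_one_pfFactor (i L : ℕ) :
    (pfFactor i L).count 0 + (pfFactor i L).count 1 = L := by
  induction L with
  | zero => simp [pfFactor]
  | succ L ih =>
    simp only [pfFactor] at ih
    have := pf_le_one (i + L)
    simp only [pfFactor, List.range_succ, List.map_append, List.count_append, List.map_cons,
      List.map_nil, List.count_singleton]
    interval_cases pf (i + L) <;> simp <;> omega

/-- The number of ones in the window of length `L` that follows position `a`. -/
def windowOnes (L a : ℕ) : ℕ := (pfFactor (a + 1) L).count 1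

lemma windowOnes_add (L a : ℕ) : windowOnes L a + pfOnes a = pfOnes (a + L) :=
  count_one_pfFactor a L

lemma rho_eq_ncard_range (L : ℕ) : ρ L = (Set.range (windowOnes L)).ncard := by
  have h : {p : ℕ × ℕ | ∃ i : ℕ, 1 ≤ i ∧
      p = ((pfFactor i L).count 0, (pfFactor i L).count 1)} =
      (fun c => (L - c, c)) '' Set.range (windowOnes L) := by
    ext ⟨x, y⟩
    simp only [Set.mem_ofPred_eq, Set.mem_image, Set.exists_range_iff, Prod.mk.injEq, windowOnes]
    constructor
    · rintro ⟨i, hi, rfl, rfl⟩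
      have := count_zero_add_count_one_pfFactor i L
      refine ⟨i - 1, ?_⟩
      rw [Nat.sub_add_cancel hi]
      omega
    · rintro ⟨a, rfl, rfl⟩
      have := count_zero_add_count_one_pfFactor (a + 1) L
      exact ⟨a + 1, by omega, by omega, rfl⟩
  rw [ρ, h, Set.ncard_image_of_injective]
  intro c d hcd
  exact (Prod.mk.inj hcd).2

lemma exists_eq_of_step_le_one {f : ℕ → ℕ}
    (hstep : ∀ a, f (a + 1) ≤ f a + 1 ∧ f a ≤ f (a + 1) + 1) {v : ℕ} (a k : ℕ)
    (h : f a ≤ v ∧ v ≤ f (a + k) ∨ f (a + k) ≤ v ∧ v ≤ f a) : ∃ b, f b = v := by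
  induction k with
  | zero => exact ⟨a, by simp only [add_zero] at h; omega⟩
  | succ k ih =>
    by_cases hv : f (a + (k + 1)) = v
    · exact ⟨_, hv⟩
    · have := hstep (a + k)
      rw [← add_assoc] at h hv
      exact ih (by omega)

/-- A bounded sequence of naturals with steps at most one takes an interval of values. -/
lemma exists_range_eq_Icc {f : ℕ → ℕ}
    (hstep : ∀ a, f (a + 1) ≤ f a + 1 ∧ f a ≤ f (a + 1) + 1) {B : ℕ} (hB : ∀ a, f a ≤ B) :
    ∃ p q, Set.range f = Set.Icc (f p) (f q) := by
  have hfin : (Set.range f).Finite :=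
    (Set.finite_Iic B).subset (by rintro _ ⟨a, rfl⟩; exact hB a)
  obtain ⟨_, ⟨p, rfl⟩, hp⟩ := hfin.exists_minimal (Set.range_nonempty f)
  obtain ⟨_, ⟨q, rfl⟩, hq⟩ := hfin.exists_maximal (Set.range_nonempty f)
  refine ⟨p, q, Set.Subset.antisymm ?_ ?_⟩
  · rintro _ ⟨a, rfl⟩
    have hpa := @hp (f a) ⟨a, rfl⟩
    have hqa := @hq (f a) ⟨a, rfl⟩
    simp only [Set.mem_Icc]
    omega
  · rintro v ⟨hpv, hvq⟩
    rcases le_total p q with h | h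
    · obtain ⟨k, rfl⟩ := Nat.exists_eq_add_of_le h
      exact exists_eq_of_step_le_one hstep p k (Or.inl ⟨hpv, hvq⟩)
    · obtain ⟨k, rfl⟩ := Nat.exists_eq_add_of_le h
      exact exists_eq_of_step_le_one hstep q k (Or.inr ⟨hpv, hvq⟩)

lemma exists_range_windowOnes_eq_Icc (L : ℕ) :
    ∃ p q, Set.range (windowOnes L) = Set.Icc (windowOnes L p) (windowOnes L q) := by
  refine exists_range_eq_Icc (B := L) (fun a => ?_) (fun a => ?_)
  · have h := windowOnes_add L a
    have h' := windowOnes_add L (a + 1)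
    rw [show a + 1 + L = a + L + 1 by ring, pfOnes_succ, pfOnes_succ] at h'
    have := pf_le_one (a + 1)
    have := pf_le_one (a + L + 1)
    omega
  · have := count_zero_add_count_one_pfFactor (a + 1) L
    unfold windowOnes
    omega

/-- For every window of length `2n+1` there are windows of length `16n+9` whose number of ones
exceeds, respectively falls short of, that of the given window plus `7n+4` by one. -/
lemma exists_windowOnes_sixteen (n b : ℕ) :
    (∃ a, windowOnes (16 * n + 9) a = windowOnes (2 * n + 1) b + 7 * n + 5) ∧
    ∃ a, windowOnes (16 * n + 9) a = windowOnes (2 * n + 1) b + 7 * n + 3 := by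
  have hb := windowOnes_add (2 * n + 1) b
  obtain ⟨c, rfl | rfl⟩ := b.even_or_odd'
  · have hc := pfOnes_block c
    have hd := pfOnes_block (c + n)
    refine ⟨⟨16 * c + 5, ?_⟩, ⟨16 * c + 1, ?_⟩⟩
    · have ha := windowOnes_add (16 * n + 9) (16 * c + 5)
      grind
    · have ha := windowOnes_add (16 * n + 9) (16 * c + 1)
      grind
  · have hc := pfOnes_block c
    have hd := pfOnes_block (c + n + 1)
    refine ⟨⟨16 * c + 10, ?_⟩, ⟨16 * c + 12, ?_⟩⟩
    · have ha := windowOnes_add (16 * n + 9) (16 * c + 10)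
      grind
    · have ha := windowOnes_add (16 * n + 9) (16 * c + 12)
      grind

/-- The number of ones in a window of length `16n+9` differs by at most one from `7n+4` plus the
number of ones in some window of length `2n+1`. -/
lemma exists_windowOnes_bounds (n a : ℕ) : ∃ b,
    windowOnes (16 * n + 9) a ≤ windowOnes (2 * n + 1) b + 7 * n + 5 ∧
    windowOnes (2 * n + 1) b + 7 * n + 3 ≤ windowOnes (16 * n + 9) a := by
  have ha := windowOnes_add (16 * n + 9) a
  obtain ⟨c, r, hr, rfl⟩ : ∃ c r, r < 16 ∧ a = 16 * c + r :=
    ⟨a / 16, a % 16, Nat.mod_lt _ (by norm_num), (Nat.div_add_mod a 16).symm⟩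
  have hc := pfOnes_block c
  have hc0 := pfOnes_sixteen_mul c
  have hd := pfOnes_block (c + n)
  have hd1 := pfOnes_block (c + n + 1)
  have hd0 := pfOnes_sixteen_mul (c + n + 1)
  have h0 := windowOnes_add (2 * n + 1) (2 * c)
  have h1 := windowOnes_add (2 * n + 1) (2 * c + 1)
  have s1 := pfOnes_succ (2 * (c + n) + 1)
  have s2 := pfOnes_succ (2 * (c + n + 1))
  have l1 := pf_le_one (2 * (c + n) + 1 + 1)
  have l2 := pf_le_one (2 * (c + n + 1) + 1)
  rw [show 2 * c + (2 * n + 1) = 2 * (c + n) + 1 by ring] at h0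
  rw [show 2 * c + 1 + (2 * n + 1) = 2 * (c + n + 1) by ring] at h1
  rw [show 2 * (c + n) + 1 + 1 = 2 * (c + n + 1) by ring] at s1 l1
  rw [show 16 * c + r + (16 * n + 9) = 16 * (c + n) + (r + 9) by ring] at ha
  have e (s : ℕ) : 16 * (c + n) + (16 + s) = 16 * (c + n + 1) + s := by ring
  rcases lt_or_ge r 8 with h | h
  · refine ⟨2 * c, ?_⟩
    obtain rfl | h := eq_or_ne r 7
    · rw [show 7 + 9 = 16 + 0 by rfl, e, add_zero] at ha
      omega
    · have : r < 7 := by omega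
      interval_cases r <;> simp only [Nat.reduceAdd, add_zero, hc, hc0, hd] at ha ⊢ <;>
        clear hc hd hd1 <;> omega
  · refine ⟨2 * c + 1, ?_⟩
    obtain ⟨t, rfl⟩ := Nat.exists_eq_add_of_le h
    rw [show 8 + t + 9 = 16 + (t + 1) by ring, e] at ha
    have ht : t < 8 := by omega
    interval_cases t <;> simp only [Nat.reduceAdd, zero_add, add_zero, hc, hd1] at ha ⊢ <;>
      clear hc hd hd1 <;> omega

theorem pf_rho_sixteen_mul_add_nine : ∀ n : ℕ, ρ (16 * n + 9) = ρ (2 * n + 1) + 2 := by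
  intro n
  obtain ⟨p, q, h⟩ := exists_range_windowOnes_eq_Icc (2 * n + 1)
  obtain ⟨p', q', h'⟩ := exists_range_windowOnes_eq_Icc (16 * n + 9)
  have hmem (a : ℕ) : windowOnes (2 * n + 1) p ≤ windowOnes (2 * n + 1) a ∧
      windowOnes (2 * n + 1) a ≤ windowOnes (2 * n + 1) q := by
    have := Set.mem_range_self (f := windowOnes (2 * n + 1)) a
    rwa [h] at this
  have hmem' (a : ℕ) : windowOnes (16 * n + 9) p' ≤ windowOnes (16 * n + 9) a ∧
      windowOnes (16 * n + 9) a ≤ windowOnes (16 * n + 9) q' := by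
    have := Set.mem_range_self (f := windowOnes (16 * n + 9)) a
    rwa [h'] at this
  obtain ⟨a, ha⟩ := (exists_windowOnes_sixteen n q).1
  obtain ⟨a', ha'⟩ := (exists_windowOnes_sixteen n p).2
  obtain ⟨b, hb, -⟩ := exists_windowOnes_bounds n q'
  obtain ⟨b', -, hb'⟩ := exists_windowOnes_bounds n p'
  have := hmem b
  have := hmem b'
  have := hmem' a
  have := hmem' a'
  rw [rho_eq_ncard_range, rho_eq_ncard_range, h, h', Set.ncard_eq_toFinset_card',
    Set.ncard_eq_toFinset_card', Set.toFinset_Icc, Set.toFinset_Icc, Nat.card_Icc, Nat.card_Icc]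
  omega
end

section
/- Let ρ be the abelian complexity function of the ordinary paperfolding word, and for i ≥ 1 let A(i) = min{n ∈ ℕ, n ≥ 1 : ρ(n) = i + 1}. Then for every i ≥ 1, A(i) = (2^i + 1)/3 if i is odd, and A(i) = (2^i + 2)/3 if i is even. -/
/-- `A i` is the least `n ≥ 1` with `ρ(n) = i + 1`. -/
noncomputable def A (i : ℕ) : ℕ := sInf {n : ℕ | 1 ≤ n ∧ ρ n = i + 1}

theorem pf_eq_zero_or_one (n : ℕ) : pf n = 0 ∨ pf n = 1 := by
  unfold pf
  split_ifs <;> simp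

theorem pf_two_mul_s16 {n : ℕ} (hn : n ≠ 0) : pf (2 * n) = pf n := by
  have h : (2 * n).factorization 2 = n.factorization 2 + 1 := by
    rw [Nat.factorization_mul two_ne_zero hn, Nat.Prime.factorization Nat.prime_two]
    simp [add_comm]
  unfold pf
  rw [h, pow_succ', Nat.mul_div_mul_left _ _ two_pos]

theorem pf_two_mul_add_one (n : ℕ) : pf (2 * n + 1) = n % 2 := by
  have h : (2 * n + 1).factorization 2 = 0 :=
    Nat.factorization_eq_zero_of_not_dvd (by omega)
  unfold pf
  rw [h, pow_zero, Nat.div_one]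
  split_ifs <;> omega

/-- The number of `0`s minus the number of `1`s in the prefix of length `n` of the
paperfolding word. -/
def pfPrefixSum : ℕ → ℤ
  | 0 => 0
  | n + 1 => pfPrefixSum n + (1 - 2 * (pf (n + 1) : ℤ))

theorem pfPrefixSum_succ (n : ℕ) :
    pfPrefixSum (n + 1) = pfPrefixSum n + (1 - 2 * (pf (n + 1) : ℤ)) := rfl

theorem pfPrefixSum_succ_eq (n : ℕ) :
    pfPrefixSum (n + 1) = pfPrefixSum n + 1 ∨ pfPrefixSum (n + 1) = pfPrefixSum n - 1 := by
  rw [pfPrefixSum_succ]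
  have := pf_eq_zero_or_one (n + 1)
  omega

theorem pfPrefixSum_emod_two (n : ℕ) : pfPrefixSum n % 2 = (n : ℤ) % 2 := by
  induction n with
  | zero => rfl
  | succ n ih =>
    have := pfPrefixSum_succ_eq n
    push_cast
    omega

theorem pfPrefixSum_two_mul (n : ℕ) :
    pfPrefixSum (2 * n) = pfPrefixSum n + ((n % 2 : ℕ) : ℤ) := by
  induction n with
  | zero => rfl
  | succ n ih =>
    rw [show 2 * (n + 1) = 2 * n + 1 + 1 by ring, pfPrefixSum_succ, pfPrefixSum_succ,
      show 2 * n + 1 + 1 = 2 * (n + 1) by ring, pf_two_mul_s16 (by omega), pf_two_mul_add_one,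
      pfPrefixSum_succ n, ih]
    omega

theorem pfPrefixSum_two_mul_add_one (n : ℕ) :
    pfPrefixSum (2 * n + 1) = pfPrefixSum n + 1 - ((n % 2 : ℕ) : ℤ) := by
  rw [pfPrefixSum_succ, pfPrefixSum_two_mul, pf_two_mul_add_one]
  ring

theorem two_pow_mod_three (d : ℕ) :
    (d % 2 = 0 ∧ 2 ^ d % 3 = 1) ∨ (d % 2 = 1 ∧ 2 ^ d % 3 = 2) := by
  induction d with
  | zero => simp
  | succ d ih =>
    rw [pow_succ]
    omega

/-- Factors with large imbalance are long. -/
theorem two_pow_natAbs_lt {a b : ℕ} (hab : a ≤ b) (h : pfPrefixSum b ≠ pfPrefixSum a) :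
    2 ^ (pfPrefixSum b - pfPrefixSum a).natAbs < 3 * (b - a) := by
  induction b using Nat.strong_induction_on generalizing a with
  | _ b ih =>
  have hlt : a < b := lt_of_le_of_ne hab (by rintro rfl; exact h rfl)
  obtain ⟨d, hd⟩ : ∃ d, d = (pfPrefixSum b - pfPrefixSum a).natAbs := ⟨_, rfl⟩
  rw [← hd]
  rcases Nat.lt_or_ge d 2 with hd2 | hd2
  · have : d = 1 := by omega
    subst this
    omega
  have ha := pfPrefixSum_emod_two a
  have hb := pfPrefixSum_emod_two b
  have halve : ∀ n, pfPrefixSum n = pfPrefixSum (n / 2) ∨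
      pfPrefixSum n = pfPrefixSum (n / 2) + 1 := by
    intro n
    have h0 := pfPrefixSum_two_mul (n / 2)
    have h1 := pfPrefixSum_two_mul_add_one (n / 2)
    rcases Nat.mod_two_eq_zero_or_one n with hn | hn
    · rw [show 2 * (n / 2) = n by omega] at h0
      omega
    · rw [show 2 * (n / 2) + 1 = n by omega] at h1
      omega
  have ha' := halve a
  have hb' := halve b
  have key := ih (b / 2) (by omega) (a := a / 2) (by omega) (by omega)
  have hpow : 2 ^ (d - 1) ≤ 2 ^ (pfPrefixSum (b / 2) - pfPrefixSum (a / 2)).natAbs :=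
    Nat.pow_le_pow_right two_pos (by omega)
  have h3 := two_pow_mod_three (d - 1)
  have hdouble : 2 ^ d = 2 * 2 ^ (d - 1) := by
    rw [← pow_succ']
    congr 1
    omega
  omega

/-- The least length of a factor with imbalance `i`, for `i ≥ 1`. -/
def minLength (i : ℕ) : ℕ := (2 ^ i + 2) / 3

theorem three_mul_minLength (i : ℕ) :
    (i % 2 = 0 ∧ 3 * minLength i = 2 ^ i + 2) ∨ (i % 2 = 1 ∧ 3 * minLength i = 2 ^ i + 1) := by
  have := two_pow_mod_three i
  unfold minLength
  omega

theorem minLength_succ_of_odd {i : ℕ} (hi : i % 2 = 1) :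
    minLength (i + 1) = 2 * minLength i := by
  have h1 := three_mul_minLength i
  have h2 := three_mul_minLength (i + 1)
  rw [pow_succ] at h2
  omega

theorem minLength_succ_of_even {i : ℕ} (hi : i % 2 = 0) :
    minLength (i + 1) + 1 = 2 * minLength i := by
  have h1 := three_mul_minLength i
  have h2 := three_mul_minLength (i + 1)
  rw [pow_succ] at h2
  omega

theorem minLength_emod_two {i : ℕ} (hi : 1 ≤ i) : minLength i % 2 = i % 2 := by
  obtain ⟨j, rfl⟩ := Nat.exists_eq_add_of_le' hi
  rcases Nat.mod_two_eq_zero_or_one j with hj | hj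
  · have := minLength_succ_of_even hj
    omega
  · have := minLength_succ_of_odd hj
    omega

theorem exists_pfPrefixSum_add_minLength_eq_add {i : ℕ} (hi : 1 ≤ i) :
    ∃ a, a % 2 = 1 ∧ pfPrefixSum (a + minLength i) = pfPrefixSum a + i := by
  induction i, hi using Nat.le_induction with
  | base =>
    have h1 := pfPrefixSum_two_mul 1
    exact ⟨1, rfl, h1⟩
  | succ i hi ih =>
    obtain ⟨a, ha, h⟩ := ih
    have hpar := minLength_emod_two hi
    have hb1 := pfPrefixSum_two_mul_add_one (a + minLength i)
    have hb0 := pfPrefixSum_two_mul (a + minLength i)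
    have ha1 := pfPrefixSum_two_mul_add_one a
    refine ⟨2 * a + 1, by omega, ?_⟩
    rcases Nat.mod_two_eq_zero_or_one i with h2 | h2
    · have := minLength_succ_of_even h2
      rw [show 2 * a + 1 + minLength (i + 1) = 2 * (a + minLength i) by omega]
      omega
    · rw [minLength_succ_of_odd h2,
        show 2 * a + 1 + 2 * minLength i = 2 * (a + minLength i) + 1 by omega]
      omega

theorem exists_pfPrefixSum_add_minLength_eq_sub {i : ℕ} (hi : 1 ≤ i) :
    ∃ a, a % 2 = i % 2 ∧ pfPrefixSum (a + minLength i) = pfPrefixSum a - i := by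
  induction i, hi using Nat.le_induction with
  | base =>
    have h1 := pfPrefixSum_two_mul 1
    have h2 := pfPrefixSum_two_mul_add_one 1
    have h3 := pfPrefixSum_two_mul 3
    have h5 := pfPrefixSum_two_mul_add_one 2
    refine ⟨5, rfl, ?_⟩
    rw [show 5 + minLength 1 = 6 from rfl]
    norm_num at h1 h2 h3 h5 ⊢
    omega
  | succ i hi ih =>
    obtain ⟨a, ha, h⟩ := ih
    have hpar := minLength_emod_two hi
    have hb0 := pfPrefixSum_two_mul (a + minLength i)
    have ha0 := pfPrefixSum_two_mul a
    have ha1 := pfPrefixSum_two_mul_add_one a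
    rcases Nat.mod_two_eq_zero_or_one i with h2 | h2
    · have := minLength_succ_of_even h2
      refine ⟨2 * a + 1, by omega, ?_⟩
      rw [show 2 * a + 1 + minLength (i + 1) = 2 * (a + minLength i) by omega]
      omega
    · refine ⟨2 * a, by omega, ?_⟩
      rw [minLength_succ_of_odd h2, ← mul_add]
      omega

theorem pfFactor_succ (i n : ℕ) : pfFactor i (n + 1) = pfFactor i n ++ [pf (i + n)] := by
  simp [pfFactor, List.range_succ]

theorem count_zero_add_count_one (i n : ℕ) :
    (pfFactor i n).count 0 + (pfFactor i n).count 1 = n := by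
  induction n with
  | zero => rfl
  | succ n ih =>
    rw [pfFactor_succ, List.count_append, List.count_append]
    rcases pf_eq_zero_or_one (i + n) with h | h <;> rw [h] <;> simp <;> omega

theorem two_mul_count_zero (a n : ℕ) :
    2 * ((pfFactor (a + 1) n).count 0 : ℤ) = n + (pfPrefixSum (a + n) - pfPrefixSum a) := by
  induction n with
  | zero => simp [pfFactor]
  | succ n ih =>
    rw [pfFactor_succ, List.count_append, ← add_assoc, pfPrefixSum_succ,
      show a + 1 + n = a + n + 1 by ring]
    rcases pf_eq_zero_or_one (a + n + 1) with h | h <;> rw [h] <;> simp <;> omega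

theorem ρ_eq_ncard_range (n : ℕ) :
    ρ n = (Set.range fun a => (pfFactor (a + 1) n).count 0).ncard := by
  have h : {p : ℕ × ℕ | ∃ i : ℕ, 1 ≤ i ∧
      p = ((pfFactor i n).count 0, (pfFactor i n).count 1)} =
      (fun z => (z, n - z)) '' Set.range fun a => (pfFactor (a + 1) n).count 0 := by
    ext p
    constructor
    · rintro ⟨i, hi, rfl⟩
      obtain ⟨a, rfl⟩ := Nat.exists_eq_add_of_le' hi
      have := count_zero_add_count_one (a + 1) n
      exact ⟨_, ⟨a, rfl⟩, Prod.ext rfl (by dsimp only; omega)⟩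
    · rintro ⟨_, ⟨a, rfl⟩, rfl⟩
      have := count_zero_add_count_one (a + 1) n
      exact ⟨a + 1, by omega, Prod.ext rfl (by dsimp only; omega)⟩
  rw [ρ, h, Set.ncard_image_of_injective]
  exact fun x y hxy => congrArg Prod.fst hxy

/-- A discrete intermediate value theorem. -/
theorem exists_eq_of_step_le_one_s16 {f : ℕ → ℕ} (hf : ∀ k, f (k + 1) ≤ f k + 1 ∧ f k ≤ f (k + 1) + 1)
    {p q v : ℕ} (hp : f p ≤ v) (hq : v ≤ f q) : ∃ k, f k = v := by
  by_contra! hne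
  have h : ∀ k, f k < v ↔ f 0 < v := by
    intro k
    induction k with
    | zero => rfl
    | succ k ih =>
      have := hf k
      have := hne k
      have := hne (k + 1)
      omega
  have := h p
  have := h q
  have := hne p
  have := hne q
  omega

theorem count_zero_step (a n : ℕ) :
    (pfFactor (a + 1 + 1) n).count 0 ≤ (pfFactor (a + 1) n).count 0 + 1 ∧
      (pfFactor (a + 1) n).count 0 ≤ (pfFactor (a + 1 + 1) n).count 0 + 1 := by
  have h1 := two_mul_count_zero a n
  have h2 := two_mul_count_zero (a + 1) n
  have h3 := pfPrefixSum_succ_eq a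
  have h4 := pfPrefixSum_succ_eq (a + n)
  rw [add_right_comm a 1 n] at h2
  omega

/-- Factors shorter than `minLength (i + 1)` have imbalance at most `i`. -/
theorem abs_pfPrefixSum_sub_le {n i : ℕ} (h : n < minLength (i + 1)) (a : ℕ) :
    |pfPrefixSum (a + n) - pfPrefixSum a| ≤ i := by
  by_contra! hlt
  rw [Int.abs_eq_natAbs] at hlt
  have hkey := two_pow_natAbs_lt (Nat.le_add_right a n) (by intro he; simp [he] at hlt; omega)
  have hpow : 2 ^ (i + 1) ≤ 2 ^ (pfPrefixSum (a + n) - pfPrefixSum a).natAbs :=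
    Nat.pow_le_pow_right two_pos (by omega)
  have h3 := three_mul_minLength (i + 1)
  omega

theorem ρ_le_of_lt_minLength {n i : ℕ} (h : n < minLength (i + 1)) : ρ n ≤ i + 1 := by
  have hsub : (Set.range fun a => (pfFactor (a + 1) n).count 0) ⊆
      (Finset.Icc ((n + 1 - i) / 2) ((n + i) / 2) : Set ℕ) := by
    rintro _ ⟨a, rfl⟩
    have h1 := abs_le.mp (abs_pfPrefixSum_sub_le h a)
    have h2 := two_mul_count_zero a n
    simp only [Finset.coe_Icc, Set.mem_Icc]
    omega
  rw [ρ_eq_ncard_range]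
  refine (Set.ncard_le_ncard hsub (Finset.finite_toSet _)).trans ?_
  rw [Set.ncard_coe_finset, Nat.card_Icc]
  omega

theorem ρ_minLength {i : ℕ} (hi : 1 ≤ i) : ρ (minLength i) = i + 1 := by
  apply le_antisymm
  · apply ρ_le_of_lt_minLength
    have h1 := three_mul_minLength i
    have h2 := three_mul_minLength (i + 1)
    have h3 : 2 ^ 1 ≤ 2 ^ i := Nat.pow_le_pow_right two_pos hi
    rw [pow_succ] at h2
    omega
  · obtain ⟨q, -, hq⟩ := exists_pfPrefixSum_add_minLength_eq_add hi
    obtain ⟨p, -, hp⟩ := exists_pfPrefixSum_add_minLength_eq_sub hi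
    have hq' := two_mul_count_zero q (minLength i)
    have hp' := two_mul_count_zero p (minLength i)
    have hsub : (Finset.Icc ((pfFactor (p + 1) (minLength i)).count 0)
        ((pfFactor (q + 1) (minLength i)).count 0) : Set ℕ) ⊆
        Set.range fun a => (pfFactor (a + 1) (minLength i)).count 0 := by
      intro v hv
      rw [Finset.coe_Icc, Set.mem_Icc] at hv
      exact exists_eq_of_step_le_one_s16 (fun k => count_zero_step k _) hv.1 hv.2
    have hfin : (Set.range fun a => (pfFactor (a + 1) (minLength i)).count 0).Finite := by
      refine (Set.finite_Iic (minLength i)).subset ?_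
      rintro _ ⟨a, rfl⟩
      have := count_zero_add_count_one (a + 1) (minLength i)
      simp only [Set.mem_Iic]
      omega
    rw [ρ_eq_ncard_range]
    refine le_trans ?_ (Set.ncard_le_ncard hsub hfin)
    rw [Set.ncard_coe_finset, Nat.card_Icc]
    omega

theorem A_eq_minLength {i : ℕ} (hi : 1 ≤ i) : A i = minLength i := by
  have hpos : 1 ≤ minLength i := by
    have := Nat.two_pow_pos i
    unfold minLength
    omega
  apply le_antisymm
  · exact Nat.sInf_le ⟨hpos, ρ_minLength hi⟩
  · refine le_csInf ⟨_, hpos, ρ_minLength hi⟩ ?_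
    rintro n ⟨-, hn⟩
    by_contra! hlt
    obtain ⟨j, rfl⟩ := Nat.exists_eq_add_of_le' hi
    have := ρ_le_of_lt_minLength hlt
    omega

/-- For `i ≥ 1`, `A(i) = (2^i + 1)/3` if `i` is odd and `A(i) = (2^i + 2)/3`
if `i` is even. -/
theorem pf_A_formula : ∀ i : ℕ, 1 ≤ i →
    (Odd i → 3 * A i = 2 ^ i + 1) ∧ (Even i → 3 * A i = 2 ^ i + 2) := by
  intro i hi
  rw [A_eq_minLength hi, Nat.odd_iff, Nat.even_iff]
  have := three_mul_minLength i
  omega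
end
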